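/- Forward and backward annotation transitions with a fixed label are deterministic: for any annotation DAG A and label a = (p, Rd, Wt), (i) if A ⇀a A' and A ⇀a A'' then A' = A''; and (ii) if A' ⇀a A and A'' ⇀a A then A' = A''. -/

import Mathlib

namespace CRIL

/-- Process identifiers: finite lists of positive integers. -/
abbrev PID := List ℕ+

/-- Nodes of an annotation DAG: either ⊥ or a pair (p, n). -/
inductive ANode where
  | bot : ANode
  | node : PID → ℕ → ANode
deriving DecidableEq

/-- Labeled edges. -/
abbrev AEdge (R : Type) := ANode × R × ANode

/-- Annotation DAGs, with the five defining conditions. -/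
structure AnnDAG (R : Type) where
  V : Set ANode
  ER : Set (AEdge R)
  EW : Set (AEdge R)
  finV : V.Finite
  bot_mem : ANode.bot ∈ V
  down : ∀ p n, ANode.node p n ∈ V → ∀ n' ≤ n, ANode.node p n' ∈ V
  edges_sub : ∀ e ∈ ER ∪ EW, e.1 ∈ V ∧ e.2.2 ∈ V
  in_unique : ∀ v' v'' r v, (v', r, v) ∈ ER ∪ EW → (v'', r, v) ∈ ER ∪ EW → v' = v''
  disj : ER ∩ EW = ∅
  acyclic : ∀ v, ¬ Relation.TransGen (fun a b => ∃ r, (a, r, b) ∈ ER ∪ EW) v v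
  w_pred : ∀ v' r v, (v', r, v) ∈ EW → v' ≠ ANode.bot → ∃ v'', (v'', r, v') ∈ EW
  w_out_unique : ∀ v r v' v'', (v, r, v') ∈ EW → (v, r, v'') ∈ EW → v' = v''

-- `last(r, E_W)`: the final node of the unique maximal chain of `r`-labeled
-- `E_W`-edges starting at ⊥ (⊥ if there is no such edge).
open Classical in
noncomputable def lastN {R : Type} (EW : Set (AEdge R)) (r : R) : ANode :=
  if h : ∃! v, Relation.ReflTransGen (fun a b => (a, r, b) ∈ EW) ANode.bot v ∧
      ∀ w, (v, r, w) ∉ EW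
  then h.exists.choose
  else ANode.bot

/-- `max_p(V) + 1`: one plus the largest `n` with `(p,n) ∈ V` (0 if none). -/
noncomputable def maxpSucc (V : Set ANode) (p : PID) : ℕ :=
  sSup {m : ℕ | ∃ n, m = n + 1 ∧ ANode.node p n ∈ V}

/-- `max_p(V)` as an integer, −1 if no `(p,n) ∈ V`. -/
noncomputable def maxp (V : Set ANode) (p : PID) : ℤ :=
  (maxpSucc V p : ℤ) - 1

/-- Labels (p, Rd, Wt). -/
abbrev Label (R : Type) := PID × Set R × Set R

/-- Forward annotation transition A₁ ⇀(p,Rd,Wt) A₂. -/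
def Step {R : Type} (A₁ A₂ : AnnDAG R) (p : PID) (Rd Wt : Set R) : Prop :=
  A₂.V = A₁.V ∪ {ANode.node p (maxpSucc A₁.V p)} ∧
  A₂.ER = A₁.ER ∪
    {e | ∃ r ∈ Rd \ Wt, e = (lastN A₁.EW r, r, ANode.node p (maxpSucc A₁.V p))} ∧
  A₂.EW = A₁.EW ∪
    {e | ∃ r ∈ Wt, e = (lastN A₁.EW r, r, ANode.node p (maxpSucc A₁.V p))}

/-- Forward transition with some label. -/
def StepAny {R : Type} (A₁ A₂ : AnnDAG R) : Prop := ∃ p Rd Wt, Step A₁ A₂ p Rd Wt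

/-- Forward transition with some label in `O`. -/
def StepIn {R : Type} (O : Set (Label R)) (A₁ A₂ : AnnDAG R) : Prop :=
  ∃ l ∈ O, Step A₁ A₂ l.1 l.2.1 l.2.2

/-- The initial annotation DAG ({⊥}, ∅, ∅). -/
def Ainit (R : Type) : AnnDAG R where
  V := {ANode.bot}
  ER := ∅
  EW := ∅
  finV := Set.finite_singleton _
  bot_mem := rfl
  down := by intro p n h; simp at h
  edges_sub := by intro e he; simp at he
  in_unique := by intro v' v'' r v h; simp at h
  disj := by simp
  acyclic := by
    intro v h
    have hne : ∀ a b : ANode, ¬ ∃ r : R, (a, r, b) ∈ (∅ ∪ ∅ : Set (AEdge R)) := by simp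
    cases h with
    | single h' => exact hne _ _ h'
    | tail _ h' => exact hne _ _ h'
  w_pred := by intro v' r v h; simp at h
  w_out_unique := by intro v r v' v'' h; simp at h

/-- Signed labels: forward or underlined (backward). -/
inductive SLabel (R : Type) where
  | fwd : Label R → SLabel R
  | bwd : Label R → SLabel R

/-- `und`: forget the underline. -/
def und {R : Type} : SLabel R → Label R
  | .fwd a => a
  | .bwd a => a

/-- The underline-toggle. -/
def toggle {R : Type} : SLabel R → SLabel R
  | .fwd a => .bwd a
  | .bwd a => .fwd a

/-- Combined transitions: forward, or reversed forward. -/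
def CStep {R : Type} (A A' : AnnDAG R) : SLabel R → Prop
  | .fwd a => Step A A' a.1 a.2.1 a.2.2
  | .bwd a => Step A' A a.1 a.2.1 a.2.2

/-- Independence of signed labels: incomparable pids and disjoint read/write sets. -/
def indepLab {R : Type} (α β : SLabel R) : Prop :=
  ¬ (und α).1 <+: (und β).1 ∧ ¬ (und β).1 <+: (und α).1 ∧
  (und α).2.1 ∩ (und β).2.2 = ∅ ∧ (und β).2.1 ∩ (und α).2.2 = ∅

/-- `diff` of a combined transition. -/
def diff {R : Type} (A A' : AnnDAG R) (α : SLabel R) :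
    Set ANode × Set (AEdge R) × Set (AEdge R) :=
  match α with
  | .fwd _ => (A'.V \ A.V, A'.ER \ A.ER, A'.EW \ A.EW)
  | .bwd _ => (A.V \ A'.V, A.ER \ A'.ER, A.EW \ A'.EW)

/-- The underlying triple of an annotation DAG. -/
def triple {R : Type} (A : AnnDAG R) : Set ANode × Set (AEdge R) × Set (AEdge R) :=
  (A.V, A.ER, A.EW)

/-- The ⊙^α operation on triples. -/
def odot {R : Type} (α : SLabel R)
    (T Δ : Set ANode × Set (AEdge R) × Set (AEdge R)) :
    Set ANode × Set (AEdge R) × Set (AEdge R) :=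
  match α with
  | .fwd _ => (T.1 ∪ Δ.1, T.2.1 ∪ Δ.2.1, T.2.2 ∪ Δ.2.2)
  | .bwd _ => (T.1 \ Δ.1, T.2.1 \ Δ.2.1, T.2.2 \ Δ.2.2)


theorem AnnDAG.ext_triple {R : Type} {A B : AnnDAG R} (hV : A.V = B.V) (hR : A.ER = B.ER)
    (hW : A.EW = B.EW) : A = B := by
  cases A
  cases B
  simp_all

theorem lt_maxpSucc {V : Set ANode} (hV : V.Finite) {p : PID} {n : ℕ}
    (h : ANode.node p n ∈ V) : n < maxpSucc V p := by
  have hfin : {m : ℕ | ∃ n, m = n + 1 ∧ ANode.node p n ∈ V}.Finite := by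
    have hpre : {n : ℕ | ANode.node p n ∈ V}.Finite :=
      hV.preimage fun a _ b _ hab => (ANode.node.inj hab).2
    refine (hpre.image (· + 1)).subset ?_
    rintro m ⟨n, rfl, hn⟩
    exact ⟨n, hn, rfl⟩
  exact le_csSup hfin.bddAbove ⟨n, rfl, h⟩

theorem node_maxpSucc_notMem {R : Type} (A : AnnDAG R) (p : PID) :
    ANode.node p (maxpSucc A.V p) ∉ A.V :=
  fun h => lt_irrefl _ (lt_maxpSucc A.finV h)

/-- The node added by a forward step is at least as large as any other node of the same process
in the target. -/
theorem Step.le_maxpSucc {R : Type} {A₁ A₂ : AnnDAG R} {p : PID} {Rd Wt : Set R}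
    (h : Step A₁ A₂ p Rd Wt) {n : ℕ} (hn : ANode.node p n ∈ A₂.V) :
    n ≤ maxpSucc A₁.V p := by
  rw [h.1] at hn
  rcases hn with hn | hn
  · exact (lt_maxpSucc A₁.finV hn).le
  · exact (ANode.node.inj hn).2.le

theorem Step.node_mem {R : Type} {A₁ A₂ : AnnDAG R} {p : PID} {Rd Wt : Set R}
    (h : Step A₁ A₂ p Rd Wt) : ANode.node p (maxpSucc A₁.V p) ∈ A₂.V := by
  rw [h.1]
  exact Or.inr rfl

/-- The source of a forward step is recovered by deleting the added node and its incoming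
edges. -/
theorem Step.source_eq {R : Type} {A₁ A₂ : AnnDAG R} {p : PID} {Rd Wt : Set R}
    (h : Step A₁ A₂ p Rd Wt) :
    A₁.V = A₂.V \ {ANode.node p (maxpSucc A₁.V p)} ∧
    A₁.ER = {e ∈ A₂.ER | e.2.2 ≠ ANode.node p (maxpSucc A₁.V p)} ∧
    A₁.EW = {e ∈ A₂.EW | e.2.2 ≠ ANode.node p (maxpSucc A₁.V p)} := by
  obtain ⟨hV, hR, hW⟩ := h
  have hv := node_maxpSucc_notMem A₁ p
  have htarget : ∀ e ∈ A₁.ER ∪ A₁.EW, e.2.2 ≠ ANode.node p (maxpSucc A₁.V p) :=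
    fun e he heq => hv (heq ▸ (A₁.edges_sub e he).2)
  refine ⟨?_, ?_, ?_⟩
  · rw [hV, Set.union_sdiff_right, Set.sdiff_singleton_eq_self hv]
  · ext e
    rw [hR]
    refine ⟨fun he => ⟨Or.inl he, htarget e (Or.inl he)⟩, ?_⟩
    rintro ⟨he | ⟨r, -, rfl⟩, hne⟩
    exacts [he, absurd rfl hne]
  · ext e
    rw [hW]
    refine ⟨fun he => ⟨Or.inl he, htarget e (Or.inr he)⟩, ?_⟩
    rintro ⟨he | ⟨r, -, rfl⟩, hne⟩
    exacts [he, absurd rfl hne]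

/-- forward and backward annotation transitions with a fixed label are
deterministic. -/
theorem stmt4 {R : Type} (A : AnnDAG R) (p : PID) (Rd Wt : Set R) :
    (∀ A' A'' : AnnDAG R, Step A A' p Rd Wt → Step A A'' p Rd Wt → A' = A'') ∧
    (∀ A' A'' : AnnDAG R, Step A' A p Rd Wt → Step A'' A p Rd Wt → A' = A'') := by
  refine ⟨fun A' A'' h' h'' => ?_, fun A' A'' h' h'' => ?_⟩
  · exact AnnDAG.ext_triple (h'.1.trans h''.1.symm) (h'.2.1.trans h''.2.1.symm)
      (h'.2.2.trans h''.2.2.symm)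
  · have hmax : maxpSucc A'.V p = maxpSucc A''.V p :=
      le_antisymm (h''.le_maxpSucc h'.node_mem) (h'.le_maxpSucc h''.node_mem)
    obtain ⟨hV', hR', hW'⟩ := h'.source_eq
    obtain ⟨hV'', hR'', hW''⟩ := h''.source_eq
    rw [hmax] at hV' hR' hW'
    exact AnnDAG.ext_triple (hV'.trans hV''.symm) (hR'.trans hR''.symm) (hW'.trans hW''.symm)

end CRIL
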